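/- arXiv:1906.02251 — 6 statements merged into one kernel-verified Lean document; each statement's English description precedes it below -/
import Mathlib

section
/- There exists a constant $C > 0$ such that the Fourier transform $\hat h(\xi) = \int_{\mathbb{R}} e^{-2\pi i x\xi} h(x)\,dx$ of the function $h(x) = \chi_{(-1,1)}(x)\,|x|^{-1/2}$ satisfies $|\hat h(\xi)| \le C\,(1+|\xi|)^{-1/2}$ for all $\xi \in \mathbb{R}$. -/
open MeasureTheory FourierTransform Real

/-- Near the singularity, `∫₀ᵃ x^{-1/2} e^{itx} dx` is bounded by its absolute value. -/
lemma norm_integral_rpow_mul_exp_le_of_zero (t : ℝ) {a : ℝ} (ha : 0 ≤ a) :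
    ‖∫ x in (0 : ℝ)..a, ((x ^ (-(1/2 : ℝ)) : ℝ) : ℂ) * Complex.exp (t * x * Complex.I)‖
      ≤ 2 * a ^ (1/2 : ℝ) := by
  have hval : ∫ x in (0 : ℝ)..a, x ^ (-(1/2 : ℝ)) = 2 * a ^ (1/2 : ℝ) := by
    rw [integral_rpow (Or.inl (by norm_num))]
    norm_num
    ring
  rw [← hval]
  refine intervalIntegral.norm_integral_le_of_norm_le ha (.of_forall fun x hx => ?_)
    (intervalIntegral.intervalIntegrable_rpow' (by norm_num))
  rw [norm_mul, ← Complex.ofReal_mul, Complex.norm_exp_ofReal_mul_I, mul_one, Complex.norm_real,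
    Real.norm_of_nonneg (rpow_nonneg hx.1.le _)]

/-- Away from the singularity, one integration by parts gains a factor `|t|⁻¹`. -/
lemma norm_integral_rpow_mul_exp_le_of_pos {t : ℝ} (ht : t ≠ 0) {a : ℝ} (ha : 0 < a)
    (ha1 : a ≤ 1) :
    ‖∫ x in a..1, ((x ^ (-(1/2 : ℝ)) : ℝ) : ℂ) * Complex.exp (t * x * Complex.I)‖
      ≤ 2 * a ^ (-(1/2 : ℝ)) / |t| := by
  have hpos : ∀ x ∈ Set.uIcc a 1, 0 < x := fun x hx => by
    rw [Set.uIcc_of_le ha1] at hx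
    exact ha.trans_le hx.1
  have hnot : (0 : ℝ) ∉ Set.uIcc a 1 := fun h => lt_irrefl _ (hpos 0 h)
  have htI : (t : ℂ) * Complex.I ≠ 0 := by simp [ht]
  set v : ℝ → ℂ := fun x => Complex.exp (t * x * Complex.I) / (t * Complex.I) with hv
  have hvnorm : ∀ x, ‖v x‖ = |t|⁻¹ := fun x => by
    simp only [hv]
    rw [norm_div, ← Complex.ofReal_mul, Complex.norm_exp_ofReal_mul_I]
    simp
  have hu : ∀ x ∈ Set.uIcc a 1, HasDerivAt (fun x : ℝ => ((x ^ (-(1/2 : ℝ)) : ℝ) : ℂ))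
      ((-(1/2) * x ^ (-(3/2 : ℝ)) : ℝ) : ℂ) x := fun x hx => by
    have := (Real.hasDerivAt_rpow_const (p := -(1/2 : ℝ)) (Or.inl (hpos x hx).ne')).ofReal_comp
    convert this using 4
    norm_num
  have hv' : ∀ x ∈ Set.uIcc a 1, HasDerivAt v (Complex.exp (t * x * Complex.I)) x := fun x _ => by
    have h1 : HasDerivAt (fun x : ℝ => (t : ℂ) * x * Complex.I) (t * 1 * Complex.I) x :=
      ((Complex.ofRealCLM.hasDerivAt (x := x)).const_mul (t : ℂ)).mul_const Complex.I
    have := h1.cexp.div_const (t * Complex.I)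
    rwa [mul_one, mul_div_assoc, div_self htI, mul_one] at this
  have hi : IntervalIntegrable (fun x : ℝ => x ^ (-(3/2 : ℝ))) volume a 1 :=
    intervalIntegral.intervalIntegrable_rpow (Or.inr hnot)
  have hu'int : IntervalIntegrable (fun x : ℝ => ((-(1/2) * x ^ (-(3/2 : ℝ)) : ℝ) : ℂ))
      volume a 1 :=
    ⟨(hi.const_mul _).1.ofReal, (hi.const_mul _).2.ofReal⟩
  have hv'int : IntervalIntegrable (fun x : ℝ => Complex.exp (t * x * Complex.I)) volume a 1 :=
    Continuous.intervalIntegrable (by fun_prop) _ _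
  rw [intervalIntegral.integral_mul_deriv_eq_deriv_mul hu hv' hu'int hv'int]
  have hrem : ‖∫ x in a..1, ((-(1/2) * x ^ (-(3/2 : ℝ)) : ℝ) : ℂ) * v x‖
      ≤ (a ^ (-(1/2 : ℝ)) - 1) * |t|⁻¹ := by
    have hval : ∫ x in a..1, (1/2 * x ^ (-(3/2 : ℝ))) * |t|⁻¹
        = (a ^ (-(1/2 : ℝ)) - 1) * |t|⁻¹ := by
      rw [intervalIntegral.integral_mul_const, intervalIntegral.integral_const_mul,
        integral_rpow (Or.inr ⟨by norm_num, hnot⟩)]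
      norm_num
      ring_nf
      simp
    rw [← hval]
    refine intervalIntegral.norm_integral_le_of_norm_le ha1 (.of_forall fun x hx => ?_)
      ((hi.const_mul _).mul_const _)
    have hx0 : 0 ≤ x ^ (-(3/2 : ℝ)) := rpow_nonneg (ha.trans hx.1).le _
    rw [norm_mul, hvnorm, Complex.norm_real, norm_mul, Real.norm_of_nonneg hx0]
    norm_num
  have hend : ‖(((1 : ℝ) ^ (-(1/2 : ℝ)) : ℝ) : ℂ) * v 1‖ = |t|⁻¹ := by
    rw [norm_mul, hvnorm]; simp
  have hstart : ‖((a ^ (-(1/2 : ℝ)) : ℝ) : ℂ) * v a‖ = a ^ (-(1/2 : ℝ)) * |t|⁻¹ := by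
    rw [norm_mul, hvnorm, Complex.norm_real, Real.norm_of_nonneg (rpow_nonneg ha.le _)]
  calc _ ≤ |t|⁻¹ + a ^ (-(1/2 : ℝ)) * |t|⁻¹ + (a ^ (-(1/2 : ℝ)) - 1) * |t|⁻¹ := by
        refine (norm_sub_le _ _).trans (add_le_add ((norm_sub_le _ _).trans ?_) hrem)
        rw [hend, hstart]
    _ = _ := by ring

lemma intervalIntegrable_rpow_mul_exp (t a b : ℝ) :
    IntervalIntegrable
      (fun x : ℝ => ((x ^ (-(1/2 : ℝ)) : ℝ) : ℂ) * Complex.exp (t * x * Complex.I))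
      volume a b := by
  have h : IntervalIntegrable (fun x : ℝ => x ^ (-(1/2 : ℝ))) volume a b :=
    intervalIntegral.intervalIntegrable_rpow' (by norm_num)
  have hc : IntervalIntegrable (fun x : ℝ => ((x ^ (-(1/2 : ℝ)) : ℝ) : ℂ)) volume a b :=
    ⟨h.1.ofReal, h.2.ofReal⟩
  exact hc.mul_continuousOn (Continuous.continuousOn (by fun_prop))

lemma norm_integral_rpow_mul_exp_le (t : ℝ) :
    ‖∫ x in (0 : ℝ)..1, ((x ^ (-(1/2 : ℝ)) : ℝ) : ℂ) * Complex.exp (t * x * Complex.I)‖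
      ≤ 6 * (1 + |t|) ^ (-(1/2 : ℝ)) := by
  have h2 : 2/3 ≤ (2 : ℝ) ^ (-(1/2 : ℝ)) := by
    rw [rpow_neg (by norm_num), ← sqrt_eq_rpow, ← inv_inv (2/3 : ℝ)]
    refine inv_anti₀ (by positivity) (sqrt_le_iff.2 ?_)
    norm_num
  rcases le_total |t| 1 with h | h
  · have hle : (2 : ℝ) ^ (-(1/2 : ℝ)) ≤ (1 + |t|) ^ (-(1/2 : ℝ)) :=
      rpow_le_rpow_of_nonpos (by positivity) (by linarith) (by norm_num)
    have := norm_integral_rpow_mul_exp_le_of_zero t zero_le_one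
    rw [one_rpow] at this
    linarith
  · have ht : 0 < |t| := by linarith
    have hle : (2 * |t|) ^ (-(1/2 : ℝ)) ≤ (1 + |t|) ^ (-(1/2 : ℝ)) :=
      rpow_le_rpow_of_nonpos (by positivity) (by linarith) (by norm_num)
    rw [mul_rpow (by norm_num) ht.le] at hle
    have hnear := norm_integral_rpow_mul_exp_le_of_zero t (inv_nonneg.2 ht.le)
    have hfar := norm_integral_rpow_mul_exp_le_of_pos (abs_pos.1 ht) (inv_pos.2 ht)
      (inv_le_one_of_one_le₀ h)
    have hs : (|t|⁻¹) ^ (1/2 : ℝ) = |t| ^ (-(1/2 : ℝ)) := by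
      rw [inv_rpow ht.le, rpow_neg ht.le]
    have hs' : 2 * (|t|⁻¹) ^ (-(1/2 : ℝ)) / |t| = 2 * |t| ^ (-(1/2 : ℝ)) := by
      rw [inv_rpow ht.le, ← rpow_neg ht.le, mul_div_assoc, ← rpow_sub_one ht.ne']
      norm_num
    rw [hs] at hnear
    rw [hs'] at hfar
    rw [← intervalIntegral.integral_add_adjacent_intervals
      (intervalIntegrable_rpow_mul_exp t 0 |t|⁻¹) (intervalIntegrable_rpow_mul_exp t |t|⁻¹ 1)]
    have hmul := mul_le_mul_of_nonneg_right h2 (rpow_nonneg ht.le (-(1/2 : ℝ)))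
    refine (norm_add_le _ _).trans ?_
    linarith

/-- Folding the Fourier integral of `χ_{(-1,1)}(x) |x|^{-1/2}` onto `(0,1)`. -/
lemma fourier_indicator_abs_rpow_eq (ξ : ℝ) :
    𝓕 (fun x : ℝ => ((Set.Ioo (-1 : ℝ) 1 |>.indicator
            fun x : ℝ => |x| ^ (-(1/2 : ℝ))) x : ℂ)) ξ
      = (∫ x in (0 : ℝ)..1, ((x ^ (-(1/2 : ℝ)) : ℝ) : ℂ) *
            Complex.exp ((2 * π * ξ : ℝ) * x * Complex.I))
        + ∫ x in (0 : ℝ)..1, ((x ^ (-(1/2 : ℝ)) : ℝ) : ℂ) *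
            Complex.exp ((-(2 * π * ξ) : ℝ) * x * Complex.I) := by
  set g : ℝ → ℂ := fun x => ((|x| ^ (-(1/2 : ℝ)) : ℝ) : ℂ) *
    Complex.exp ((-(2 * π * ξ) : ℝ) * x * Complex.I) with hg
  have hright : Set.EqOn g (fun x : ℝ => ((x ^ (-(1/2 : ℝ)) : ℝ) : ℂ) *
      Complex.exp ((-(2 * π * ξ) : ℝ) * x * Complex.I)) (Set.uIcc 0 1) := fun x hx => by
    rw [Set.uIcc_of_le zero_le_one] at hx
    simp only [hg, abs_of_nonneg hx.1]
  have hleft : Set.EqOn (fun x => g (-x)) (fun x : ℝ => ((x ^ (-(1/2 : ℝ)) : ℝ) : ℂ) *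
      Complex.exp ((2 * π * ξ : ℝ) * x * Complex.I)) (Set.uIcc 0 1) := fun x hx => by
    rw [Set.uIcc_of_le zero_le_one] at hx
    simp only [hg, abs_neg, abs_of_nonneg hx.1]
    push_cast
    ring_nf
  have hgr : IntervalIntegrable g volume 0 1 :=
    (intervalIntegrable_rpow_mul_exp _ 0 1).congr
      (hright.symm.mono Set.uIoc_subset_uIcc)
  have hgl : IntervalIntegrable g volume (-1) 0 := by
    have h : IntervalIntegrable (fun x => g (-x)) volume 0 1 :=
      (intervalIntegrable_rpow_mul_exp _ 0 1).congr (hleft.symm.mono Set.uIoc_subset_uIcc)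
    simpa using ((IntervalIntegrable.iff_comp_neg).1 h).symm
  have hfold : ∫ x in (-1 : ℝ)..0, g x = ∫ x in (0 : ℝ)..1, g (-x) := by
    simp
  calc _ = ∫ x, (Set.Ioo (-1 : ℝ) 1).indicator g x := by
        rw [Real.fourier_eq']
        refine integral_congr_ae (.of_forall fun x => ?_)
        by_cases hx : x ∈ Set.Ioo (-1 : ℝ) 1
        · simp [hx, hg]
          ring_nf
        · simp [hx]
    _ = ∫ x in (-1 : ℝ)..1, g x := by
        rw [integral_indicator measurableSet_Ioo,
          intervalIntegral.integral_of_le (by norm_num), integral_Ioc_eq_integral_Ioo]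
    _ = _ := by
        rw [← intervalIntegral.integral_add_adjacent_intervals hgl hgr, hfold,
          intervalIntegral.integral_congr hleft, intervalIntegral.integral_congr hright]

/-- The Fourier transform of `h(x) = χ_{(-1,1)}(x) |x|^{-1/2}` decays like
`(1 + |ξ|)^{-1/2}`: there is `C > 0` with `|ĥ(ξ)| ≤ C (1+|ξ|)^{-1/2}` for all `ξ`. -/
theorem fourier_decay_of_data :
    ∃ C : ℝ, 0 < C ∧ ∀ ξ : ℝ,
      ‖𝓕 (fun x : ℝ => ((Set.Ioo (-1 : ℝ) 1 |>.indicator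
            fun x : ℝ => |x| ^ (-(1/2 : ℝ))) x : ℂ)) ξ‖
        ≤ C * (1 + |ξ|) ^ (-(1/2 : ℝ)) := by
  refine ⟨12, by norm_num, fun ξ => ?_⟩
  rw [fourier_indicator_abs_rpow_eq]
  have hplus := norm_integral_rpow_mul_exp_le (2 * π * ξ)
  have hminus := norm_integral_rpow_mul_exp_le (-(2 * π * ξ))
  rw [abs_neg] at hminus
  have habs : |ξ| ≤ |2 * π * ξ| := by
    rw [abs_mul, abs_of_pos two_pi_pos]
    exact le_mul_of_one_le_left (abs_nonneg ξ) (by linarith [pi_gt_three])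
  have hmono : (1 + |2 * π * ξ|) ^ (-(1/2 : ℝ)) ≤ (1 + |ξ|) ^ (-(1/2 : ℝ)) :=
    rpow_le_rpow_of_nonpos (by positivity) (by linarith) (by norm_num)
  refine (norm_add_le _ _).trans ?_
  linarith
end

section
/- Let $f, g : \mathbb{R} \to \mathbb{C}$ be continuously differentiable. Define $\phi_+(x,t) = \int_{x-t}^{x+t} |g(s)|^2\,ds$, $\phi_-(x,t) = \int_{x-t}^{x+t} |f(s)|^2\,ds$, and set $u(x,t) = f(x-t)\,e^{i\phi_+(x,t)}$, $v(x,t) = g(x+t)\,e^{i\phi_-(x,t)}$. Then $u$ and $v$ are continuously differentiable on $\mathbb{R}^2$ and satisfy $(\partial_t + \partial_x)u = 2i\,|v|^2\,u$ and $(\partial_t - \partial_x)v = 2i\,|u|^2\,v$ everywhere, together with the initial conditions $u(x,0) = f(x)$ and $v(x,0) = g(x)$. -/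
open Complex

/-- The primitive of a continuous function is continuously differentiable. -/
theorem contDiff_one_intervalIntegral {h : ℝ → ℝ} (hh : Continuous h) (c : ℝ) :
    ContDiff ℝ 1 (fun y => ∫ s in c..y, h s) := by
  rw [contDiff_one_iff_deriv]
  refine ⟨fun y => (hh.integral_hasStrictDerivAt c y).hasDerivAt.differentiableAt, ?_⟩
  rwa [funext fun y => hh.deriv_integral h c y]

theorem intervalIntegral_eq_primitive_sub {h : ℝ → ℝ} (hh : Continuous h) (a b : ℝ) :
    ∫ s in a..b, h s = (∫ s in (0 : ℝ)..b, h s) - ∫ s in (0 : ℝ)..a, h s :=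
  (intervalIntegral.integral_interval_sub_left
    (hh.intervalIntegrable _ _) (hh.intervalIntegrable _ _)).symm

/-- An amplitude times a phase given by an integral with `C¹` endpoints is `C¹`. -/
theorem ContDiff.mul_exp_I_integral {E : Type*} [NormedAddCommGroup E] [NormedSpace ℝ E]
    {h : ℝ → ℝ} (hh : Continuous h) {A : E → ℂ} {a b : E → ℝ}
    (hA : ContDiff ℝ 1 A) (ha : ContDiff ℝ 1 a) (hb : ContDiff ℝ 1 b) :
    ContDiff ℝ 1 (fun p => A p * Complex.exp (I * ((∫ s in a p..b p, h s : ℝ) : ℂ))) := by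
  simp_rw [fun r => intervalIntegral_eq_primitive_sub hh (a r) (b r)]
  have hP := contDiff_one_intervalIntegral hh 0
  exact hA.mul (contDiff_const.mul
    (ofRealCLM.contDiff.comp ((hP.comp hb).sub (hP.comp ha)))).cexp

theorem HasDerivAt.mul_exp_I_integral {h : ℝ → ℝ} (hh : Continuous h) {A : ℝ → ℂ} {A' : ℂ}
    {a b : ℝ → ℝ} {a' b' τ : ℝ}
    (hA : HasDerivAt A A' τ) (ha : HasDerivAt a a' τ) (hb : HasDerivAt b b' τ) :
    HasDerivAt (fun r => A r * Complex.exp (I * ((∫ s in a r..b r, h s : ℝ) : ℂ)))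
      ((A' + A τ * I * (h (b τ) * b' - h (a τ) * a')) *
        Complex.exp (I * ((∫ s in a τ..b τ, h s : ℝ) : ℂ))) τ := by
  simp_rw [fun r => intervalIntegral_eq_primitive_sub hh (a r) (b r)]
  have hP (y : ℝ) := (hh.integral_hasStrictDerivAt 0 y).hasDerivAt
  have hphase := (((hP (b τ)).comp τ hb).sub ((hP (a τ)).comp τ ha)).ofReal_comp
  refine (hA.mul (hphase.const_mul I).cexp).congr_deriv ?_
  simp only [Function.comp_apply, Pi.sub_apply]
  push_cast
  ring

theorem norm_mul_exp_I_mul_ofReal (z : ℂ) (r : ℝ) : ‖z * Complex.exp (I * (r : ℂ))‖ = ‖z‖ := by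
  rw [norm_mul, mul_comm I, norm_exp_ofReal_mul_I, mul_one]

/-- Explicit solution of the massless Thirring system: with
`φ₊(x,t) = ∫_{x-t}^{x+t} |g|²`, `φ₋(x,t) = ∫_{x-t}^{x+t} |f|²`,
the functions `u(x,t) = f(x-t) e^{iφ₊(x,t)}`, `v(x,t) = g(x+t) e^{iφ₋(x,t)}` are `C¹`
and satisfy `(∂_t + ∂_x)u = 2i|v|²u`, `(∂_t - ∂_x)v = 2i|u|²v`, with `u(x,0) = f(x)`,
`v(x,0) = g(x)`. -/
theorem massless_explicit_solution (f g : ℝ → ℂ)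
    (hf : ContDiff ℝ 1 f) (hg : ContDiff ℝ 1 g)
    (u v : ℝ → ℝ → ℂ)
    (hu : ∀ x t : ℝ, u x t
      = f (x - t) * Complex.exp (Complex.I * ((∫ s in (x - t)..(x + t), (‖g s‖ : ℝ) ^ 2 : ℝ) : ℂ)))
    (hv : ∀ x t : ℝ, v x t
      = g (x + t) * Complex.exp (Complex.I * ((∫ s in (x - t)..(x + t), (‖f s‖ : ℝ) ^ 2 : ℝ) : ℂ))) :
    ContDiff ℝ 1 (fun p : ℝ × ℝ => u p.1 p.2) ∧
    ContDiff ℝ 1 (fun p : ℝ × ℝ => v p.1 p.2) ∧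
    (∀ x t : ℝ,
      deriv (fun τ : ℝ => u x τ) t + deriv (fun y : ℝ => u y t) x
        = 2 * Complex.I * (‖v x t‖ : ℂ) ^ 2 * u x t) ∧
    (∀ x t : ℝ,
      deriv (fun τ : ℝ => v x τ) t - deriv (fun y : ℝ => v y t) x
        = 2 * Complex.I * (‖u x t‖ : ℂ) ^ 2 * v x t) ∧
    (∀ x : ℝ, u x 0 = f x) ∧ (∀ x : ℝ, v x 0 = g x) := by
  have hf2 : Continuous fun s => ‖f s‖ ^ 2 := hf.continuous.norm.pow 2
  have hg2 : Continuous fun s => ‖g s‖ ^ 2 := hg.continuous.norm.pow 2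
  have hf' (y : ℝ) := (hf.differentiable one_ne_zero y).hasDerivAt
  have hg' (y : ℝ) := (hg.differentiable one_ne_zero y).hasDerivAt
  have hsub : ContDiff ℝ 1 fun p : ℝ × ℝ => p.1 - p.2 := contDiff_fst.sub contDiff_snd
  have hadd : ContDiff ℝ 1 fun p : ℝ × ℝ => p.1 + p.2 := contDiff_fst.add contDiff_snd
  have hsubt (x t : ℝ) : HasDerivAt (fun τ => x - τ) (-1) t := (hasDerivAt_id t).const_sub x
  have haddt (x t : ℝ) : HasDerivAt (fun τ => x + τ) 1 t := (hasDerivAt_id t).const_add x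
  have hsubx (x t : ℝ) : HasDerivAt (fun y => y - t) 1 x := (hasDerivAt_id x).sub_const t
  have haddx (x t : ℝ) : HasDerivAt (fun y => y + t) 1 x := (hasDerivAt_id x).add_const t
  simp only [hu, hv, norm_mul_exp_I_mul_ofReal]
  refine ⟨(hf.comp hsub).mul_exp_I_integral hg2 hsub hadd,
    (hg.comp hadd).mul_exp_I_integral hf2 hsub hadd, fun x t => ?_, fun x t => ?_,
    fun x => by simp, fun x => by simp⟩
  · have ht := ((hf' (x - t)).scomp t (hsubt x t)).mul_exp_I_integral hg2 (hsubt x t) (haddt x t)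
    have hx := ((hf' (x - t)).scomp x (hsubx x t)).mul_exp_I_integral hg2 (hsubx x t) (haddx x t)
    refine (congrArg₂ (· + ·) ht.deriv hx.deriv).trans ?_
    simp only [Function.comp_apply, real_smul]
    push_cast
    ring
  · have ht := ((hg' (x + t)).scomp t (haddt x t)).mul_exp_I_integral hf2 (hsubt x t) (haddt x t)
    have hx := ((hg' (x + t)).scomp x (haddx x t)).mul_exp_I_integral hf2 (hsubx x t) (haddx x t)
    refine (congrArg₂ (· - ·) ht.deriv hx.deriv).trans ?_
    simp only [Function.comp_apply, real_smul]
    push_cast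
    ring
end

section
/- Let $m \ge 0$ and let $u, v : \mathbb{R} \times [0,\infty) \to \mathbb{C}$ be continuously differentiable functions satisfying $(\partial_t + \partial_x)u = -imv + 2i|v|^2 u$ and $(\partial_t - \partial_x)v = -imu + 2i|u|^2 v$, with $u(x,0) = f(x)$ and $v(x,0) = g(x)$. Then for every $x \in \mathbb{R}$ and $t > 0$ the local charge conservation identity holds: $\int_0^t 2|u(x+t-\sigma, \sigma)|^2\,d\sigma + \int_0^t 2|v(x-t+\sigma, \sigma)|^2\,d\sigma = \int_{x-t}^{x+t}\big(|f(y)|^2 + |g(y)|^2\big)\,dy$. -/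
open Complex

open MeasureTheory Set in
/-- Integral form on a backward light cone of the conservation law `∂_t r + ∂_x j = 0` on the
half-plane `t > 0`, for a density `r` and a flux `j` continuous up to the boundary. -/
theorem integral_lightCone_of_conservation_law {r j : ℝ × ℝ → ℝ} {r' j' : ℝ × ℝ → ℝ × ℝ →L[ℝ] ℝ}
    (hrc : ContinuousOn r {p | 0 ≤ p.2}) (hjc : ContinuousOn j {p | 0 ≤ p.2})
    (hr : ∀ p : ℝ × ℝ, 0 < p.2 → HasFDerivAt r (r' p) p)
    (hj : ∀ p : ℝ × ℝ, 0 < p.2 → HasFDerivAt j (j' p) p)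
    (hrj : ∀ p : ℝ × ℝ, 0 < p.2 → r' p (0, 1) + j' p (1, 0) = 0)
    (x : ℝ) {t : ℝ} (ht : 0 < t) :
    (∫ σ in (0 : ℝ)..t, (r (x + t - σ, σ) + j (x + t - σ, σ)))
        + (∫ σ in (0 : ℝ)..t, (r (x - t + σ, σ) - j (x - t + σ, σ)))
      = ∫ y in (x - t)..(x + t), r (y, 0) := by
  -- `φ` maps the rectangle `[-1, 1] × [0, t]` onto the solid cone
  let φ : ℝ × ℝ → ℝ × ℝ := fun q => (x + (t - q.2) * q.1, q.2)
  let φ' : ℝ × ℝ → ℝ × ℝ →L[ℝ] ℝ × ℝ := fun q =>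
    ((t - q.2) • ContinuousLinearMap.fst ℝ ℝ ℝ - q.1 • ContinuousLinearMap.snd ℝ ℝ ℝ).prod
      (ContinuousLinearMap.snd ℝ ℝ ℝ)
  have hφ (q : ℝ × ℝ) : HasFDerivAt φ (φ' q) q := by
    refine HasFDerivAt.prodMk ?_ hasFDerivAt_snd
    convert (((hasFDerivAt_snd (𝕜 := ℝ) (p := q)).const_sub t).mul
      (hasFDerivAt_fst (𝕜 := ℝ) (p := q))).const_add x using 1
    · ext
      simp
    · rw [smul_neg, sub_eq_add_neg]
  have hφ1 (q : ℝ × ℝ) : φ' q (1, 0) = (t - q.2) • (1, 0) := by simp [φ']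
  have hφ2 (q : ℝ × ℝ) : φ' q (0, 1) = (0, 1) - q.1 • (1, 0) := by simp [φ']
  have hφc : Continuous φ := by fun_prop
  have hmaps : MapsTo φ (uIcc (-1) 1 ×ˢ uIcc 0 t) {p | 0 ≤ p.2} := by
    rintro q ⟨-, hq⟩
    rw [uIcc_of_le ht.le] at hq
    exact hq.1
  let Q : ℝ × ℝ → ℝ := fun q => q.1 * r (φ q) + j (φ q)
  let P : ℝ × ℝ → ℝ := fun q => (t - q.2) * r (φ q)
  have hrφ := hrc.comp hφc.continuousOn hmaps
  have hjφ := hjc.comp hφc.continuousOn hmaps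
  have hQ (q : ℝ × ℝ) (hq : 0 < q.2) := (hasFDerivAt_fst (p := q)).mul
    ((hr (φ q) hq).comp q (hφ q)) |>.add ((hj (φ q) hq).comp q (hφ q))
  have hP (q : ℝ × ℝ) (hq : 0 < q.2) := ((hasFDerivAt_snd (p := q)).const_sub t).mul
    ((hr (φ q) hq).comp q (hφ q))
  let Q' : ℝ × ℝ → ℝ × ℝ →L[ℝ] ℝ := fun q => if 0 < q.2 then fderiv ℝ Q q else 0
  let P' : ℝ × ℝ → ℝ × ℝ →L[ℝ] ℝ := fun q => if 0 < q.2 then fderiv ℝ P q else 0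
  have hdiv (q : ℝ × ℝ) : Q' q (1, 0) + P' q (0, 1) = 0 := by
    by_cases hq : 0 < q.2
    · have h1 : fderiv ℝ Q q = _ := (hQ q hq).fderiv
      have h2 : fderiv ℝ P q = _ := (hP q hq).fderiv
      have h3 := hrj (φ q) hq
      simp only [Q', P', if_pos hq, h1, h2, _root_.add_apply,
        _root_.smul_apply, ContinuousLinearMap.comp_apply, hφ1, hφ2, map_smul,
        map_sub, _root_.neg_apply, ContinuousLinearMap.coe_fst',
        ContinuousLinearMap.coe_snd', smul_eq_mul, Function.comp_apply]
      linear_combination (t - q.2) * h3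
    · simp [Q', P', hq]
  have key := integral2_divergence_prod_of_hasFDerivAt Q P Q' P' (-1) 0 1 t
    ((continuousOn_fst.mul hrφ).add hjφ)
    ((continuousOn_const.sub continuousOn_snd).mul hrφ)
    (fun q hq => by
      have hq2 : 0 < q.2 := by simpa [ht.le] using hq.2.1
      simp only [Q', if_pos hq2]
      exact (hQ q hq2).differentiableAt.hasFDerivAt)
    (fun q hq => by
      have hq2 : 0 < q.2 := by simpa [ht.le] using hq.2.1
      simp only [P', if_pos hq2]
      exact (hP q hq2).differentiableAt.hasFDerivAt)
    (by simp only [hdiv]; exact integrableOn_zero)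
  have hbase : ∫ ρ in (-1 : ℝ)..1, P (ρ, 0) = ∫ y in (x - t)..(x + t), r (y, 0) := by
    have := intervalIntegral.smul_integral_comp_add_mul (a := -1) (b := 1)
      (fun y => r (y, 0)) t x
    simpa [P, φ, intervalIntegral.integral_const_mul, ← sub_eq_add_neg] using this
  have hleft : ∫ σ in (0 : ℝ)..t, Q (-1, σ)
      = -∫ σ in (0 : ℝ)..t, (r (x - t + σ, σ) - j (x - t + σ, σ)) := by
    rw [← intervalIntegral.integral_neg]
    refine intervalIntegral.integral_congr fun σ _ => ?_
    have : φ (-1, σ) = (x - t + σ, σ) := by ext <;> simp [φ]; ring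
    simp only [Q, this]
    ring
  have hright : ∫ σ in (0 : ℝ)..t, Q (1, σ)
      = ∫ σ in (0 : ℝ)..t, (r (x + t - σ, σ) + j (x + t - σ, σ)) := by
    refine intervalIntegral.integral_congr fun σ _ => ?_
    have : φ (1, σ) = (x + t - σ, σ) := by ext <;> simp [φ]; ring
    simp only [Q, this]
    ring
  have htop : ∫ ρ in (-1 : ℝ)..1, P (ρ, t) = 0 := by simp [P]
  simp only [hdiv, intervalIntegral.integral_zero] at key
  rw [hbase, hleft, hright, htop] at key
  linarith

/-- The partial derivatives of a function on the plane are values of its Fréchet derivative. -/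
theorem deriv_partial_eq_of_hasFDerivAt {w : ℝ → ℝ → ℂ} {w' : ℝ × ℝ →L[ℝ] ℂ} {p : ℝ × ℝ}
    (hw : HasFDerivAt (fun p : ℝ × ℝ => w p.1 p.2) w' p) :
    deriv (fun τ => w p.1 τ) p.2 = w' (0, 1) ∧ deriv (fun y => w y p.2) p.1 = w' (1, 0) := by
  constructor
  · exact (HasFDerivAt.comp_hasDerivAt (l := fun p : ℝ × ℝ => w p.1 p.2) p.2 hw
      ((hasDerivAt_const p.2 p.1).prodMk (hasDerivAt_id p.2))).deriv
  · exact (HasFDerivAt.comp_hasDerivAt (l := fun p : ℝ × ℝ => w p.1 p.2) p.1 hw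
      ((hasDerivAt_id p.1).prodMk (hasDerivAt_const p.1 p.2))).deriv

/-- The charge exchanged between the two components of the Thirring system cancels. -/
theorem inner_thirring_add_inner_thirring (m : ℝ) (a b : ℂ) :
    inner ℝ a (-I * (m : ℂ) * b + 2 * I * (‖b‖ : ℂ) ^ 2 * a)
      + inner ℝ b (-I * (m : ℂ) * a + 2 * I * (‖a‖ : ℂ) ^ 2 * b) = 0 := by
  simp only [Complex.inner, ← ofReal_pow, mul_re, mul_im, add_re, add_im, neg_re, neg_im,
    conj_re, conj_im, I_re, I_im, ofReal_re, ofReal_im, re_ofNat, im_ofNat]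
  ring

/-- Local conservation of charge for the massive Thirring system: if `u, v` are `C¹`
on `ℝ × [0,∞)` and satisfy `(∂_t+∂_x)u = -imv + 2i|v|²u`, `(∂_t-∂_x)v = -imu + 2i|u|²v`
with data `u(·,0) = f`, `v(·,0) = g`, then for every `x` and `t > 0`,
`∫₀ᵗ 2|u(x+t-σ,σ)|² dσ + ∫₀ᵗ 2|v(x-t+σ,σ)|² dσ = ∫_{x-t}^{x+t} (|f|² + |g|²)`. -/
theorem thirring_local_charge_conservation (m : ℝ) (hm : 0 ≤ m)
    (u v : ℝ → ℝ → ℂ) (f g : ℝ → ℂ)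
    (hu : ContDiffOn ℝ 1 (fun p : ℝ × ℝ => u p.1 p.2) {p : ℝ × ℝ | 0 ≤ p.2})
    (hv : ContDiffOn ℝ 1 (fun p : ℝ × ℝ => v p.1 p.2) {p : ℝ × ℝ | 0 ≤ p.2})
    (hue : ∀ x : ℝ, ∀ t : ℝ, 0 < t →
      deriv (fun τ : ℝ => u x τ) t + deriv (fun y : ℝ => u y t) x
        = -Complex.I * (m : ℂ) * v x t + 2 * Complex.I * (‖v x t‖ : ℂ) ^ 2 * u x t)
    (hve : ∀ x : ℝ, ∀ t : ℝ, 0 < t →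
      deriv (fun τ : ℝ => v x τ) t - deriv (fun y : ℝ => v y t) x
        = -Complex.I * (m : ℂ) * u x t + 2 * Complex.I * (‖u x t‖ : ℂ) ^ 2 * v x t)
    (huf : ∀ x : ℝ, u x 0 = f x) (hvg : ∀ x : ℝ, v x 0 = g x) :
    ∀ x : ℝ, ∀ t : ℝ, 0 < t →
      (∫ σ in (0 : ℝ)..t, 2 * ‖u (x + t - σ) σ‖ ^ 2)
        + (∫ σ in (0 : ℝ)..t, 2 * ‖v (x - t + σ) σ‖ ^ 2)
      = ∫ y in (x - t)..(x + t), (‖f y‖ ^ 2 + ‖g y‖ ^ 2) := by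
  intro x t ht
  have hfd {w : ℝ → ℝ → ℂ}
      (hw : ContDiffOn ℝ 1 (fun p : ℝ × ℝ => w p.1 p.2) {p : ℝ × ℝ | 0 ≤ p.2})
      (p : ℝ × ℝ) (hp : 0 < p.2) :
      HasFDerivAt (fun p : ℝ × ℝ => w p.1 p.2)
        (fderiv ℝ (fun p : ℝ × ℝ => w p.1 p.2) p) p :=
    ((hw.differentiableOn one_ne_zero).differentiableAt
      (Filter.mem_of_superset ((isOpen_lt continuous_const continuous_snd).mem_nhds hp)
        fun q (hq : 0 < q.2) => hq.le)).hasFDerivAt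
  have hun := fun p hp => (hfd hu p hp).norm_sq
  have hvn := fun p hp => (hfd hv p hp).norm_sq
  have key := integral_lightCone_of_conservation_law
    ((hu.continuousOn.norm.pow 2).add (hv.continuousOn.norm.pow 2))
    ((hu.continuousOn.norm.pow 2).sub (hv.continuousOn.norm.pow 2))
    (fun p hp => (hun p hp).add (hvn p hp)) (fun p hp => (hun p hp).sub (hvn p hp))
    (fun p hp => by
      have h1 := hue p.1 p.2 hp
      have h2 := hve p.1 p.2 hp
      obtain ⟨hut, hux⟩ := deriv_partial_eq_of_hasFDerivAt (hfd hu p hp)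
      obtain ⟨hvt, hvx⟩ := deriv_partial_eq_of_hasFDerivAt (hfd hv p hp)
      rw [hut, hux] at h1
      rw [hvt, hvx] at h2
      have h3 := inner_thirring_add_inner_thirring m (u p.1 p.2) (v p.1 p.2)
      rw [← h1, ← h2, inner_add_right, inner_sub_right] at h3
      simp only [_root_.add_apply, _root_.sub_apply,
        _root_.smul_apply, ContinuousLinearMap.comp_apply, innerSL_apply_apply,
        nsmul_eq_mul, Nat.cast_ofNat]
      linear_combination 2 * h3) x ht
  simp only [Pi.add_apply, Pi.sub_apply, Pi.pow_apply, huf, hvg] at key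
  rw [← key]
  congr 1 <;> refine intervalIntegral.integral_congr fun σ _ => ?_ <;> ring
end

section
/- Fix $x, t \in \mathbb{R}$ with $t > |x|$, a complex number $\kappa \ne 0$, and nonnegative reals $a, b$ with $a + b > 0$. Then the function $\varepsilon \mapsto \dfrac{\kappa}{(\varepsilon + t - x)^{1/2}}\, e^{-i(a+b)\log\varepsilon}\, e^{ia\log(\varepsilon + x + t)}\, e^{ib\log(\varepsilon + t - x)}$, defined for $\varepsilon > 0$, has no limit as $\varepsilon \to 0^+$. -/
open Filter Topology

/-- For `c ≠ 0` the oscillating factor `ε ↦ e^{-ic log ε}` has no limit as `ε → 0⁺`: it changes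
sign under the rescaling `ε ↦ e^{-π/c} ε`. -/
theorem not_tendsto_exp_neg_I_mul_log {c : ℝ} (hc : c ≠ 0) (L : ℂ) :
    ¬ Tendsto (fun ε : ℝ => Complex.exp (-Complex.I * (c : ℂ) * (Real.log ε : ℂ)))
      (𝓝[>] (0 : ℝ)) (𝓝 L) := by
  intro h
  have hscale : Tendsto (fun ε : ℝ => Real.exp (-Real.pi / c) * ε) (𝓝[>] 0) (𝓝[>] 0) := by
    refine tendsto_nhdsWithin_iff.2 ⟨?_, ?_⟩
    · have : Tendsto (fun ε : ℝ => Real.exp (-Real.pi / c) * ε) (𝓝 0) (𝓝 0) := by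
        simpa using (continuous_const_mul (Real.exp (-Real.pi / c))).tendsto 0
      exact this.mono_left nhdsWithin_le_nhds
    · filter_upwards [self_mem_nhdsWithin] with ε hε
      exact mul_pos (Real.exp_pos _) hε
  have hneg : Tendsto (fun ε : ℝ => Complex.exp (-Complex.I * (c : ℂ) * (Real.log ε : ℂ)))
      (𝓝[>] (0 : ℝ)) (𝓝 (-L)) := by
    refine (h.comp hscale).neg.congr' ?_
    filter_upwards [self_mem_nhdsWithin] with ε hε
    have hcC : (c : ℂ) ≠ 0 := by exact_mod_cast hc
    have hexponent : -Complex.I * (c : ℂ) * (Real.log (Real.exp (-Real.pi / c) * ε) : ℂ)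
        = -Complex.I * (c : ℂ) * (Real.log ε : ℂ) + Real.pi * Complex.I := by
      rw [Real.log_mul (Real.exp_pos _).ne' (ne_of_gt hε), Real.log_exp]
      push_cast
      field_simp
      ring
    rw [Function.comp_apply, hexponent, Complex.exp_add, Complex.exp_pi_mul_I]
    ring
  have hL : L = 0 := self_eq_neg.1 (tendsto_nhds_unique h hneg)
  have hnorm : ∀ ε : ℝ, ‖Complex.exp (-Complex.I * (c : ℂ) * (Real.log ε : ℂ))‖ = 1 := by
    intro ε
    simp [Complex.norm_exp]
  have hone := h.norm
  simp only [hnorm, hL, norm_zero] at hone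
  exact one_ne_zero (tendsto_nhds_unique tendsto_const_nhds hone)

/-- Fix `t > |x|`, `κ ≠ 0`, and `a, b ≥ 0` with `a + b > 0`. Then the function
`ε ↦ κ (ε+t-x)^{-1/2} e^{-i(a+b)log ε} e^{ia log(ε+x+t)} e^{ib log(ε+t-x)}`
has no limit as `ε → 0⁺`. -/
theorem no_limit_selfsimilar_approx (x t : ℝ) (hxt : |x| < t)
    (κ : ℂ) (hκ : κ ≠ 0) (a b : ℝ) (ha : 0 ≤ a) (hb : 0 ≤ b) (hab : 0 < a + b) :
    ¬ ∃ L : ℂ, Tendsto (fun ε : ℝ =>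
        κ / (Real.sqrt (ε + t - x) : ℂ)
          * Complex.exp (-Complex.I * ((a + b : ℝ) : ℂ) * (Real.log ε : ℂ))
          * Complex.exp (Complex.I * (a : ℂ) * (Real.log (ε + x + t) : ℂ))
          * Complex.exp (Complex.I * (b : ℂ) * (Real.log (ε + t - x) : ℂ)))
        (𝓝[>] (0 : ℝ)) (𝓝 L) := by
  rintro ⟨L, hL⟩
  obtain ⟨hx, hx'⟩ := abs_lt.1 hxt
  have hminus : 0 < 0 + t - x := by linarith
  have hplus : 0 < 0 + x + t := by linarith
  let G : ℝ → ℂ := fun ε => κ / (Real.sqrt (ε + t - x) : ℂ)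
    * Complex.exp (Complex.I * (a : ℂ) * (Real.log (ε + x + t) : ℂ))
    * Complex.exp (Complex.I * (b : ℂ) * (Real.log (ε + t - x) : ℂ))
  have hsqrt : ∀ ε : ℝ, 0 < ε + t - x → (Real.sqrt (ε + t - x) : ℂ) ≠ 0 := fun ε hε => by
    exact_mod_cast (Real.sqrt_pos.2 hε).ne'
  have hG : ∀ ε : ℝ, 0 < ε + t - x → G ε ≠ 0 := fun ε hε =>
    mul_ne_zero (mul_ne_zero (div_ne_zero hκ (hsqrt ε hε)) (Complex.exp_ne_zero _))
      (Complex.exp_ne_zero _)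
  have hlog_minus : ContinuousAt (fun ε : ℝ => (Real.log (ε + t - x) : ℂ)) 0 :=
    Complex.continuous_ofReal.continuousAt.comp
      (ContinuousAt.log (by fun_prop) hminus.ne')
  have hlog_plus : ContinuousAt (fun ε : ℝ => (Real.log (ε + x + t) : ℂ)) 0 :=
    Complex.continuous_ofReal.continuousAt.comp
      (ContinuousAt.log (by fun_prop) hplus.ne')
  have hsqrt_cont : ContinuousAt (fun ε : ℝ => (Real.sqrt (ε + t - x) : ℂ)) 0 := by fun_prop
  have hG_cont : ContinuousAt G 0 :=
    ((continuousAt_const.div hsqrt_cont (hsqrt 0 hminus)).mul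
      (continuousAt_const.mul hlog_plus).cexp).mul (continuousAt_const.mul hlog_minus).cexp
  refine not_tendsto_exp_neg_I_mul_log hab.ne' (L / G 0)
    ((hL.div (hG_cont.tendsto.mono_left nhdsWithin_le_nhds) (hG 0 hminus)).congr' ?_)
  filter_upwards [self_mem_nhdsWithin] with ε hε
  have hε_pos : 0 < ε := hε
  rw [Pi.div_apply, div_eq_iff (hG ε (by linarith))]
  simp only [G]
  ring
end

section
/- Fix $\alpha \in \mathbb{R}$ and define, for $y > 0$ and $s > 0$, $u(y,s) = e^{i\alpha}\,e^{i\log y}\,\frac{e^{i\log s}}{\sqrt{s}}$ and $v(y,s) = e^{i\alpha}\,\frac{e^{i\log y}}{\sqrt{y}}\,e^{i\log s}$. Then $u$ and $v$ are differentiable on the open quadrant $\{(y,s) : y > 0, s > 0\}$ and satisfy $\partial_y u = i\,|v|^2\,u$ and $\partial_s v = i\,|u|^2\,v$ there. -/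
open Complex

theorem hasDerivAt_cexp_I_mul_log {x : ℝ} (hx : 0 < x) :
    HasDerivAt (fun t : ℝ => cexp (I * (Real.log t : ℂ)))
      (cexp (I * (Real.log x : ℂ)) * (I * ((x⁻¹ : ℝ) : ℂ))) x :=
  (((Real.hasDerivAt_log hx.ne').ofReal_comp).const_mul I).cexp

theorem differentiableAt_cexp_I_mul_log_div_sqrt {x : ℝ} (hx : 0 < x) :
    DifferentiableAt ℝ (fun t : ℝ => cexp (I * (Real.log t : ℂ)) / (Real.sqrt t : ℂ)) x :=
  (hasDerivAt_cexp_I_mul_log hx).differentiableAt.fun_div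
    (Real.hasDerivAt_sqrt hx.ne').ofReal_comp.differentiableAt
    (ofReal_ne_zero.mpr (Real.sqrt_pos.mpr hx).ne')

theorem norm_cexp_I_mul_ofReal_div_sqrt_sq (a : ℝ) {x : ℝ} (hx : 0 < x) :
    ‖cexp (I * (a : ℂ)) / (Real.sqrt x : ℂ)‖ ^ 2 = x⁻¹ := by
  rw [norm_div, norm_exp_I_mul_ofReal, norm_real, Real.norm_of_nonneg (Real.sqrt_nonneg x),
    div_pow, Real.sq_sqrt hx.le, one_pow, one_div]

/-- In null coordinates, the functions `u(y,s) = e^{iα} e^{i log y} e^{i log s}/√s` and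
`v(y,s) = e^{iα} (e^{i log y}/√y) e^{i log s}` are differentiable on the open quadrant
`y > 0, s > 0` and satisfy `∂_y u = i|v|²u`, `∂_s v = i|u|²v` there. -/
theorem null_coordinate_solution (α : ℝ) (u v : ℝ → ℝ → ℂ)
    (hu : ∀ y s : ℝ, 0 < y → 0 < s →
      u y s = Complex.exp (Complex.I * (α : ℂ)) * Complex.exp (Complex.I * (Real.log y : ℂ))
        * (Complex.exp (Complex.I * (Real.log s : ℂ)) / (Real.sqrt s : ℂ)))
    (hv : ∀ y s : ℝ, 0 < y → 0 < s →
      v y s = Complex.exp (Complex.I * (α : ℂ))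
        * (Complex.exp (Complex.I * (Real.log y : ℂ)) / (Real.sqrt y : ℂ))
        * Complex.exp (Complex.I * (Real.log s : ℂ))) :
    DifferentiableOn ℝ (fun p : ℝ × ℝ => u p.1 p.2) {p : ℝ × ℝ | 0 < p.1 ∧ 0 < p.2} ∧
    DifferentiableOn ℝ (fun p : ℝ × ℝ => v p.1 p.2) {p : ℝ × ℝ | 0 < p.1 ∧ 0 < p.2} ∧
    (∀ y s : ℝ, 0 < y → 0 < s →
      HasDerivAt (fun y' : ℝ => u y' s) (Complex.I * (‖v y s‖ : ℂ) ^ 2 * u y s) y) ∧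
    (∀ y s : ℝ, 0 < y → 0 < s →
      HasDerivAt (fun s' : ℝ => v y s') (Complex.I * (‖u y s‖ : ℂ) ^ 2 * v y s) s) := by
  have hU : ∀ y s : ℝ, 0 < y → 0 < s → (‖u y s‖ : ℂ) ^ 2 = ((s⁻¹ : ℝ) : ℂ) := by
    intro y s hy hs
    rw [hu y s hy hs, norm_mul, norm_mul, norm_exp_I_mul_ofReal, norm_exp_I_mul_ofReal, one_mul,
      one_mul, ← ofReal_pow, norm_cexp_I_mul_ofReal_div_sqrt_sq _ hs]
  have hV : ∀ y s : ℝ, 0 < y → 0 < s → (‖v y s‖ : ℂ) ^ 2 = ((y⁻¹ : ℝ) : ℂ) := by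
    intro y s hy hs
    rw [hv y s hy hs, norm_mul, norm_mul, norm_exp_I_mul_ofReal, norm_exp_I_mul_ofReal, one_mul,
      mul_one, ← ofReal_pow, norm_cexp_I_mul_ofReal_div_sqrt_sq _ hy]
  refine ⟨?_, ?_, ?_, ?_⟩
  · refine DifferentiableOn.congr (fun p hp => ?_) (fun p hp => hu p.1 p.2 hp.1 hp.2)
    exact ((((hasDerivAt_cexp_I_mul_log hp.1).differentiableAt.comp p
      differentiableAt_fst).const_mul _).fun_mul
      ((differentiableAt_cexp_I_mul_log_div_sqrt hp.2).comp p
        differentiableAt_snd)).differentiableWithinAt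
  · refine DifferentiableOn.congr (fun p hp => ?_) (fun p hp => hv p.1 p.2 hp.1 hp.2)
    exact ((((differentiableAt_cexp_I_mul_log_div_sqrt hp.1).comp p
      differentiableAt_fst).const_mul _).fun_mul
      ((hasDerivAt_cexp_I_mul_log hp.2).differentiableAt.comp p
        differentiableAt_snd)).differentiableWithinAt
  · intro y s hy hs
    rw [hV y s hy hs, hu y s hy hs]
    refine ((((hasDerivAt_cexp_I_mul_log hy).const_mul (cexp (I * α))).mul_const
      (cexp (I * Real.log s) / Real.sqrt s)).congr_deriv (by ring)).congr_of_eventuallyEq ?_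
    filter_upwards [lt_mem_nhds hy] with y' hy' using hu y' s hy' hs
  · intro y s hy hs
    rw [hU y s hy hs, hv y s hy hs]
    refine (((hasDerivAt_cexp_I_mul_log hs).const_mul
      (cexp (I * α) * (cexp (I * Real.log y) / Real.sqrt y))).congr_deriv (by ring)).congr_of_eventuallyEq ?_
    filter_upwards [lt_mem_nhds hs] with s' hs' using hv y s' hy hs'
end

section
/- Fix $\alpha \in \mathbb{R}$ and define $f : \mathbb{R}\setminus\{0\} \to \mathbb{C}$ by $f(y) = e^{-i\log(-y)}$ for $y < 0$ and $f(y) = e^{i\alpha}\,e^{i\log y}$ for $y > 0$. Let $(\delta_n)$ be a sequence of positive reals with $\delta_n \to 0$ and $e^{-2i\log\delta_n} \to e^{i\alpha}$ as $n \to \infty$. Then for every compactly supported continuously differentiable function $\theta : \mathbb{R} \to \mathbb{C}$, one has $-\int_{\mathbb{R}} f(y)\,\theta'(y)\,dy = \lim_{n\to\infty} \int_{\{|y| > \delta_n\}} \frac{i}{|y|}\,f(y)\,\theta(y)\,dy$. -/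
open MeasureTheory Filter Topology Complex

open Set in
/-- A function continuous on a closed set times a compactly supported continuous function is
integrable on that set. -/
theorem integrableOn_mul_of_hasCompactSupport {u v : ℝ → ℂ} {s : Set ℝ} (hs : IsClosed s)
    (hu : ContinuousOn u s) (hv : Continuous v) (hvc : HasCompactSupport v) :
    IntegrableOn (fun y => u y * v y) s := by
  have hc : IntegrableOn (fun y => u y * v y) (s ∩ tsupport v) :=
    ((hu.mono inter_subset_left).mul hv.continuousOn).integrableOn_compact
      (hvc.isCompact.inter_left hs)
  refine hc.of_forall_sdiff_eq_zero hs.measurableSet fun y hy => ?_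
  have hy' : y ∉ tsupport v := fun h => hy.2 ⟨hy.1, h⟩
  simp [image_eq_zero_of_notMem_tsupport hy']

/-- A product with a compactly supported factor tends to zero along any filter below the
cocompact filter. -/
theorem tendsto_mul_zero_of_hasCompactSupport {u v : ℝ → ℂ} (hvc : HasCompactSupport v)
    {l : Filter ℝ} (hl : l ≤ cocompact ℝ) : Tendsto (fun y => u y * v y) l (𝓝 0) := by
  rw [hasCompactSupport_iff_eventuallyEq, Filter.coclosedCompact_eq_cocompact] at hvc
  refine tendsto_const_nhds.congr' ?_
  filter_upwards [hvc.filter_mono hl] with y hy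
  simp [hy]

open Set in
/-- Integration by parts on `(a, ∞)` against a compactly supported `C¹` function. -/
theorem integral_Ioi_deriv_mul_of_hasCompactSupport {u u' v : ℝ → ℂ} {a : ℝ}
    (hu : ∀ y ∈ Ici a, HasDerivAt u (u' y) y) (hu' : ContinuousOn u' (Ici a))
    (hv : ContDiff ℝ 1 v) (hvc : HasCompactSupport v) :
    ∫ y in Ioi a, u' y * v y = -(u a * v a) - ∫ y in Ioi a, u y * deriv v y := by
  have huc : ContinuousOn u (Ici a) := fun y hy => (hu y hy).continuousAt.continuousWithinAt
  have h1 := (integrableOn_mul_of_hasCompactSupport isClosed_Ici hu' hv.continuous hvc).mono_set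
    Ioi_subset_Ici_self
  have h2 := (integrableOn_mul_of_hasCompactSupport isClosed_Ici huc
    (hv.continuous_deriv le_rfl) hvc.deriv).mono_set Ioi_subset_Ici_self
  have h := integral_Ioi_of_hasDerivAt_of_tendsto'
    (fun y hy => (hu y hy).mul (hv.differentiable one_ne_zero y).hasDerivAt) (h1.add h2)
    (tendsto_mul_zero_of_hasCompactSupport hvc _root_.atTop_le_cocompact)
  rw [integral_add h1 h2] at h
  simp only [Pi.mul_apply] at h
  linear_combination h

open Set in
/-- Integration by parts on `(-∞, a]` against a compactly supported `C¹` function. -/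
theorem integral_Iic_deriv_mul_of_hasCompactSupport {u u' v : ℝ → ℂ} {a : ℝ}
    (hu : ∀ y ∈ Iic a, HasDerivAt u (u' y) y) (hu' : ContinuousOn u' (Iic a))
    (hv : ContDiff ℝ 1 v) (hvc : HasCompactSupport v) :
    ∫ y in Iic a, u' y * v y = u a * v a - ∫ y in Iic a, u y * deriv v y := by
  have huc : ContinuousOn u (Iic a) := fun y hy => (hu y hy).continuousAt.continuousWithinAt
  have h1 := integrableOn_mul_of_hasCompactSupport isClosed_Iic hu' hv.continuous hvc
  have h2 := integrableOn_mul_of_hasCompactSupport isClosed_Iic huc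
    (hv.continuous_deriv le_rfl) hvc.deriv
  have h := integral_Iic_of_hasDerivAt_of_tendsto'
    (fun y hy => (hu y hy).mul (hv.differentiable one_ne_zero y).hasDerivAt) (h1.add h2)
    (tendsto_mul_zero_of_hasCompactSupport hvc _root_.atBot_le_cocompact)
  rw [integral_add h1 h2] at h
  simp only [Pi.mul_apply] at h
  linear_combination h

open Set in
/-- Integration by parts on the complement of `[-d, d]` for a function differentiable away from
the origin, against a compactly supported `C¹` function. -/
theorem integral_lt_abs_deriv_mul_of_hasCompactSupport {u u' v : ℝ → ℂ} {d : ℝ} (hd : 0 < d)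
    (hu : ∀ y ≠ 0, HasDerivAt u (u' y) y) (hu' : ContinuousOn u' {0}ᶜ)
    (hv : ContDiff ℝ 1 v) (hvc : HasCompactSupport v) :
    ∫ y in {y : ℝ | d < |y|}, u' y * v y =
      u (-d) * v (-d) - u d * v d - ∫ y in {y : ℝ | d < |y|}, u y * deriv v y := by
  have hset : {y : ℝ | d < |y|} = Iio (-d) ∪ Ioi d := by
    ext y
    simp only [mem_ofPred_eq, lt_abs, mem_union, mem_Iio, mem_Ioi]
    constructor
    · rintro (h | h)
      · exact Or.inr h
      · exact Or.inl (by linarith)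
    · rintro (h | h)
      · exact Or.inr (by linarith)
      · exact Or.inl h
  have hdisj : Disjoint (Iio (-d)) (Ioi d) :=
    (Iio_disjoint_Ici (by linarith : -d ≤ d)).mono_right Ioi_subset_Ici_self
  have hneg : Iic (-d) ⊆ ({0}ᶜ : Set ℝ) := fun y (hy : y ≤ -d) => by
    have : y < 0 := by linarith
    exact this.ne
  have hpos : Ici d ⊆ ({0}ᶜ : Set ℝ) := fun y (hy : d ≤ y) => (hd.trans_le hy).ne'
  have huc : ContinuousOn u {0}ᶜ := fun y hy => (hu y hy).continuousAt.continuousWithinAt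
  have split : ∀ {w z : ℝ → ℂ}, ContinuousOn w {0}ᶜ → Continuous z → HasCompactSupport z →
      ∫ y in {y : ℝ | d < |y|}, w y * z y =
        (∫ y in Iic (-d), w y * z y) + ∫ y in Ioi d, w y * z y := by
    intro w z hw hz hzc
    rw [hset, setIntegral_union hdisj measurableSet_Ioi, integral_Iic_eq_integral_Iio]
    · exact (integrableOn_mul_of_hasCompactSupport isClosed_Iic (hw.mono hneg) hz hzc).mono_set
        Iio_subset_Iic_self
    · exact (integrableOn_mul_of_hasCompactSupport isClosed_Ici (hw.mono hpos) hz hzc).mono_set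
        Ioi_subset_Ici_self
  rw [split hu' hv.continuous hvc, split huc (hv.continuous_deriv le_rfl) hvc.deriv,
    integral_Ioi_deriv_mul_of_hasCompactSupport (fun y hy => hu y (hpos hy)) (hu'.mono hpos) hv hvc,
    integral_Iic_deriv_mul_of_hasCompactSupport (fun y hy => hu y (hneg hy)) (hu'.mono hneg) hv hvc]
  ring

/-- Integrals over the complements of shrinking symmetric intervals converge to the integral over
the whole line. -/
theorem tendsto_setIntegral_lt_abs {g : ℝ → ℂ} (hg : Integrable g) {δ : ℕ → ℝ}
    (hδ0 : Tendsto δ atTop (𝓝 0)) :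
    Tendsto (fun n => ∫ y in {y : ℝ | δ n < |y|}, g y) atTop (𝓝 (∫ y, g y)) := by
  have hmeas : ∀ n, MeasurableSet {y : ℝ | δ n < |y|} := fun n =>
    measurableSet_lt measurable_const continuous_abs.measurable
  simp_rw [← integral_indicator (hmeas _)]
  refine tendsto_integral_of_dominated_convergence (fun y => ‖g y‖)
    (fun n => hg.aestronglyMeasurable.indicator (hmeas n)) hg.norm
    (fun n => Eventually.of_forall fun y => norm_indicator_le_norm_self _ _) ?_
  filter_upwards [Measure.ae_ne volume (0 : ℝ)] with y hy
  refine tendsto_const_nhds.congr' ?_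
  filter_upwards [hδ0.eventually_lt_const (abs_pos.mpr hy)] with n hn
  exact (Set.indicator_of_mem (s := {y : ℝ | δ n < |y|}) hn g).symm

/-- The piecewise function `f(y) = e^{-i log(-y)}` for `y < 0`, `f(y) = e^{iα} e^{i log y}`
for `y > 0`, satisfies the distributional equation `f' = (i/|y|) f` in the principal value
sense along any sequence `δₙ → 0⁺` with `e^{-2i log δₙ} → e^{iα}`: for every compactly
supported `C¹` test function `θ`,
`-∫ f θ' = lim_n ∫_{|y| > δₙ} (i/|y|) f(y) θ(y) dy`. -/
theorem pv_distributional_equation (α : ℝ) (f : ℝ → ℂ)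
    (hfneg : ∀ y : ℝ, y < 0 → f y = Complex.exp (-Complex.I * (Real.log (-y) : ℂ)))
    (hfpos : ∀ y : ℝ, 0 < y →
      f y = Complex.exp (Complex.I * (α : ℂ)) * Complex.exp (Complex.I * (Real.log y : ℂ)))
    (δ : ℕ → ℝ) (hδpos : ∀ n, 0 < δ n)
    (hδ0 : Tendsto δ atTop (𝓝 0))
    (hδα : Tendsto (fun n => Complex.exp (-2 * Complex.I * (Real.log (δ n) : ℂ)))
      atTop (𝓝 (Complex.exp (Complex.I * (α : ℂ)))))
    (θ : ℝ → ℂ) (hθ : ContDiff ℝ 1 θ) (hθc : HasCompactSupport θ) :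
    Tendsto (fun n => ∫ y in {y : ℝ | δ n < |y|},
        (Complex.I / ((|y| : ℝ) : ℂ)) * f y * θ y)
      atTop (𝓝 (-∫ y : ℝ, f y * deriv θ y)) := by
  have hnorm : ∀ t : ℝ, ‖Complex.exp (Complex.I * (t : ℂ))‖ = 1 := fun t => by
    rw [mul_comm]; exact Complex.norm_exp_ofReal_mul_I t
  have hf1 : ∀ y : ℝ, y ≠ 0 → ‖f y‖ = 1 := by
    intro y hy
    rcases lt_or_gt_of_ne hy with h | h
    · rw [hfneg y h]
      simpa using hnorm (-Real.log (-y))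
    · rw [hfpos y h, norm_mul, hnorm, hnorm, one_mul]
  have hder : ∀ y : ℝ, y ≠ 0 → HasDerivAt f (Complex.I / ((|y| : ℝ) : ℂ) * f y) y := by
    intro y hy
    have hy' : (y : ℂ) ≠ 0 := by exact_mod_cast hy
    rcases lt_or_gt_of_ne hy with h | h
    · have hl : HasDerivAt (fun x : ℝ => Real.log (-x)) y⁻¹ y := by
        simpa using Real.hasDerivAt_log hy
      have he := (hl.ofReal_comp.const_mul (-Complex.I)).cexp
      refine (he.congr_of_eventuallyEq ?_).congr_deriv ?_
      · filter_upwards [Iio_mem_nhds h] with x hx using hfneg x hx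
      · rw [hfneg y h, abs_of_neg h]
        push_cast
        field_simp
    · have he := (((Real.hasDerivAt_log hy).ofReal_comp.const_mul Complex.I).cexp).const_mul
        (Complex.exp (Complex.I * (α : ℂ)))
      refine (he.congr_of_eventuallyEq ?_).congr_deriv ?_
      · filter_upwards [Ioi_mem_nhds h] with x hx using hfpos x hx
      · rw [hfpos y h, abs_of_pos h]
        push_cast
        field_simp
  have hfc : ContinuousOn f {0}ᶜ := fun y hy => (hder y hy).continuousAt.continuousWithinAt
  have hf'c : ContinuousOn (fun y : ℝ => Complex.I / ((|y| : ℝ) : ℂ) * f y) {0}ᶜ := by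
    refine (continuousOn_const.div (by fun_prop) fun y hy => ?_).mul hfc
    exact_mod_cast abs_ne_zero.mpr hy
  have hint : Integrable (fun y => f y * deriv θ y) := by
    have hθ' : Integrable (deriv θ) :=
      (hθ.continuous_deriv le_rfl).integrable_of_hasCompactSupport hθc.deriv
    have hfm : AEStronglyMeasurable f volume := by
      rw [← Measure.restrict_eq_self_of_ae_mem (s := {0}ᶜ) (Measure.ae_ne volume (0 : ℝ))]
      exact hfc.aestronglyMeasurable (measurableSet_singleton 0).compl
    refine hθ'.norm.mono' (hfm.mul hθ'.aestronglyMeasurable) ?_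
    filter_upwards [Measure.ae_ne volume (0 : ℝ)] with y hy
    rw [norm_mul, hf1 y hy, one_mul]
  have hbdry : Tendsto (fun n => f (-δ n) * θ (-δ n) - f (δ n) * θ (δ n)) atTop (𝓝 0) := by
    have hp : Tendsto (fun n => θ (δ n)) atTop (𝓝 (θ 0)) :=
      (hθ.continuous.tendsto 0).comp hδ0
    have hm : Tendsto (fun n => θ (-δ n)) atTop (𝓝 (θ 0)) :=
      (hθ.continuous.tendsto 0).comp (by simpa using hδ0.neg)
    have hlim := (hδα.mul hm).sub (hp.const_mul (Complex.exp (Complex.I * (α : ℂ))))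
    rw [sub_self] at hlim
    refine squeeze_zero_norm (fun n => le_of_eq ?_) (tendsto_zero_iff_norm_tendsto_zero.mp hlim)
    rw [← one_mul ‖Complex.exp (-2 * Complex.I * (Real.log (δ n) : ℂ)) * _ - _‖,
      ← hnorm (Real.log (δ n)), ← norm_mul, hfneg _ (neg_neg_of_pos (hδpos n)),
      hfpos _ (hδpos n), neg_neg]
    have hexp : Complex.exp (-Complex.I * (Real.log (δ n) : ℂ)) =
        Complex.exp (Complex.I * (Real.log (δ n) : ℂ)) *
          Complex.exp (-2 * Complex.I * (Real.log (δ n) : ℂ)) := by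
      rw [← Complex.exp_add]
      ring_nf
    rw [hexp]
    ring_nf
  have hlim := hbdry.sub (tendsto_setIntegral_lt_abs hint hδ0)
  rw [zero_sub] at hlim
  exact hlim.congr fun n =>
    (integral_lt_abs_deriv_mul_of_hasCompactSupport (hδpos n) hder hf'c hθ hθc).symm
end
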